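/- Let K be a field of characteristic zero, let A be a commutative K-algebra, let G be a finite group acting on A by K-algebra automorphisms, and let s ∈ A be fixed by every element of G. Suppose A is Gorenstein with socle generator s, i.e. for every nonzero a ∈ A there exist b ∈ A and a nonzero scalar c ∈ K with a·b = c•s. Then the fixed subalgebra A^G is Gorenstein with socle generator s: for every nonzero a ∈ A with g•a = a for all g ∈ G, there exist b ∈ A with g•b = b for all g ∈ G and a nonzero scalar c ∈ K such that a·b = c•s. -/

import Mathlib

theorem stmt_6 (K : Type*) [Field K] [CharZero K] (A : Type*) [CommRing A]
    [Algebra K A] (G : Type*) [Group G] [Finite G] [MulSemiringAction G A]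
    [SMulCommClass G K A] (s : A) (hsfix : ∀ g : G, g • s = s)
    (hGor : ∀ a : A, a ≠ 0 → ∃ b : A, ∃ c : K, c ≠ 0 ∧ a * b = c • s) :
    ∀ a : A, a ≠ 0 → (∀ g : G, g • a = a) →
      ∃ b : A, (∀ g : G, g • b = b) ∧ ∃ c : K, c ≠ 0 ∧ a * b = c • s := by
  intro a ha hafix
  obtain ⟨b, c, hc, hab⟩ := hGor a ha
  have := Fintype.ofFinite G
  have translate (g : G) : a * g • b = c • s := by
    rw [← hsfix g, ← smul_comm g c s, ← hab, smul_mul', hafix]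
  refine ⟨∑ g : G, g • b, fun h => ?_, (Fintype.card G : K) * c,
    mul_ne_zero (Nat.cast_ne_zero.mpr Fintype.card_ne_zero) hc, ?_⟩
  · simp only [Finset.smul_sum, smul_smul]
    exact Fintype.sum_equiv (Equiv.mulLeft h) _ _ fun _ => rfl
  · simp [Finset.mul_sum, translate, mul_smul, Nat.cast_smul_eq_nsmul]
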